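/- Let S = k[x_0,...,x_4] be the Cox ring of the weighted projective space ℙ(1,1,1,2,2), with deg(x_0)=deg(x_1)=deg(x_2)=1 and deg(x_3)=deg(x_4)=2, and let I_C be the ideal of 2×2 minors of the matrix [[x_0, x_1, x_2², x_3],[x_1, x_2, x_3, x_4]]. Then S/I_C is Cohen–Macaulay of codimension 3. -/

import Mathlib

set_option maxHeartbeats 1000000
set_option synthInstance.maxHeartbeats 400000

open MvPolynomial

namespace Stmt17Aux

theorem dim_eq {A R : Type*} [CommRing A] [CommRing R] [Algebra A R] [Algebra.IsIntegral A R]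
    [Module.FaithfullyFlat A R] : ringKrullDim R = ringKrullDim A := by
  apply le_antisymm
  · refine Order.krullDim_le_of_strictMono (PrimeSpectrum.comap (algebraMap A R)) ?_
    intro p q hpq
    exact Ideal.IsIntegral.comap_lt_comap (R := A) (show p.asIdeal < q.asIdeal from hpq)
  · refine iSup_le fun l => ?_
    obtain ⟨Q, hQ⟩ := PrimeSpectrum.comap_surjective_of_faithfullyFlat (A := A) (B := R) l.last
    haveI : Q.asIdeal.LiesOver l.last.asIdeal := ⟨by rw [← hQ]; rfl⟩
    obtain ⟨L, hL, -, -⟩ := Ideal.exists_ltSeries_of_hasGoingDown l Q.asIdeal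
    rw [← hL]
    exact le_iSup (fun p : LTSeries (PrimeSpectrum R) => (p.length : WithBot ℕ∞)) L

/-- exponents of the basis elements -/
noncomputable def base : Fin 6 → (Fin 2 →₀ ℕ) :=
  ![0, .single 0 2 + .single 1 1, .single 0 1 + .single 1 2, .single 0 3 + .single 1 3,
    .single 0 2 + .single 1 4, .single 0 1 + .single 1 5]

noncomputable def expo (i : Fin 6) (m : Fin 2 →₀ ℕ) : Fin 2 →₀ ℕ :=
  .single 0 (3 * m 0) + .single 1 (6 * m 1) + base i

theorem expo_inj {i j : Fin 6} {m n : Fin 2 →₀ ℕ} (h : expo i m = expo j n) : i = j ∧ m = n := by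
  have h0 := DFunLike.congr_fun h 0
  have h1 := DFunLike.congr_fun h 1
  have : i = j ∧ m 0 = n 0 ∧ m 1 = n 1 := by
    fin_cases i <;> fin_cases j <;> simp [expo, base] at h0 h1 ⊢ <;> omega
  refine ⟨this.1, ?_⟩
  ext a
  fin_cases a
  · exact this.2.1
  · exact this.2.2

variable (k : Type) [Field k]

/-- the map `k[u,v] → k[s,t]`, `u ↦ s³`, `v ↦ t⁶` -/
noncomputable def psi : MvPolynomial (Fin 2) k →ₐ[k] MvPolynomial (Fin 2) k :=
  aeval ![X 0 ^ 3, X 1 ^ 6]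

theorem psi_monomial (i : Fin 6) (m : Fin 2 →₀ ℕ) (r : k) :
    psi k (monomial m r) * monomial (base i) 1 = monomial (expo i m) r := by
  rw [psi, aeval_monomial, Finsupp.prod_fintype _ _ (by simp)]
  simp only [Fin.prod_univ_two, Matrix.cons_val_zero, Matrix.cons_val_one, ← pow_mul]
  simp only [X_pow_eq_monomial, algebraMap_eq, monomial_mul, C_mul_monomial, expo, mul_one]

theorem coeff_psi (i j : Fin 6) (m : Fin 2 →₀ ℕ) (c : MvPolynomial (Fin 2) k) :
    coeff (expo i m) (psi k c * monomial (base j) 1) = if i = j then coeff m c else 0 := by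
  induction c using MvPolynomial.induction_on' with
  | monomial n r =>
    rw [psi_monomial, coeff_monomial, coeff_monomial]
    by_cases h : expo j n = expo i m
    · obtain ⟨rfl, rfl⟩ := expo_inj h
      simp
    · rw [if_neg h]
      split_ifs with h1 h2
      · subst h1 h2; exact absurd rfl h
      · rfl
      · rfl
  | add p q hp hq =>
    rw [map_add, add_mul, coeff_add, hp, hq]
    split_ifs <;> simp

theorem psi_indep (c : Fin 6 → MvPolynomial (Fin 2) k)
    (h : ∑ j, psi k (c j) * monomial (base j) 1 = 0) : c = 0 := by
  funext i
  ext m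
  have := congrArg (coeff (expo i m)) h
  simpa [coeff_sum, coeff_psi] using this

/-- The abstract consequence of freeness. -/
theorem free_consequences {R : Type} [CommRing R] [Algebra (MvPolynomial (Fin 2) k) R]
    (e : (Fin 6 → MvPolynomial (Fin 2) k) ≃ₗ[MvPolynomial (Fin 2) k] R) :
    ringKrullDim R = 2 ∧
    IsSMulRegular R (algebraMap (MvPolynomial (Fin 2) k) R (X 0)) ∧
    IsSMulRegular (R ⧸ Ideal.span {algebraMap (MvPolynomial (Fin 2) k) R (X 0)})
      (Ideal.Quotient.mk (Ideal.span {algebraMap (MvPolynomial (Fin 2) k) R (X 0)})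
        (algebraMap (MvPolynomial (Fin 2) k) R (X 1))) := by
  refine ⟨?_, ?_, ?_⟩
  · haveI : Module.Free (MvPolynomial (Fin 2) k) R := Module.Free.of_equiv e
    haveI : Module.Finite (MvPolynomial (Fin 2) k) R := Module.Finite.equiv e
    haveI : Nontrivial R := e.symm.toEquiv.nontrivial
    rw [dim_eq (A := MvPolynomial (Fin 2) k), MvPolynomial.ringKrullDim_of_isNoetherianRing,
      ringKrullDim_eq_zero_of_field]
    simp
  · refine (isSMulRegular_iff_right_eq_zero_of_smul).2 ?_
    intro u hu
    obtain ⟨c, rfl⟩ := e.surjective u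
    rw [smul_eq_mul, ← Algebra.smul_def, ← map_smul, map_eq_zero_iff e e.injective] at hu
    rw [map_eq_zero_iff e e.injective]
    funext i
    have := congrFun hu i
    simpa using this
  · refine (isSMulRegular_iff_right_eq_zero_of_smul).2 ?_
    intro u hu
    obtain ⟨u, rfl⟩ := Ideal.Quotient.mk_surjective u
    rw [smul_eq_mul, ← map_mul, Ideal.Quotient.eq_zero_iff_mem, Ideal.mem_span_singleton] at hu
    rw [Ideal.Quotient.eq_zero_iff_mem, Ideal.mem_span_singleton]
    obtain ⟨v, hv⟩ := hu
    obtain ⟨c, rfl⟩ := e.surjective u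
    obtain ⟨d, rfl⟩ := e.surjective v
    rw [← Algebra.smul_def, ← Algebra.smul_def, ← map_smul, ← map_smul] at hv
    have hcd := e.injective hv
    have key : ∀ i, (X 0 : MvPolynomial (Fin 2) k) ∣ c i := by
      intro i
      have h := congrFun hcd i
      simp only [Pi.smul_apply, smul_eq_mul] at h
      have h2 : (X 0 : MvPolynomial (Fin 2) k) ∣ X 1 * c i := ⟨_, h⟩
      rcases X_dvd_mul_iff.1 h2 with h3 | h3
      · rw [X_dvd_X] at h3
        exact absurd h3 (by decide)
      · exact h3
    choose b hb using key
    refine ⟨e b, ?_⟩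
    rw [← Algebra.smul_def, ← map_smul]
    congr 1
    funext i
    simpa using hb i

/-- the six generators -/
def gens {R : Type} [CommRing R] (x1 x2 x3 : R) : Fin 6 → R :=
  ![1, x1, x2, x1 * x2, x2 ^ 2, x3]

theorem span_top {A R : Type} [CommRing A] [CommRing R] [Algebra A R] (a0 a4 : A) (x1 x2 x3 : R)
    (h1 : algebraMap A R a0 * x2 = x1 ^ 2) (h2 : algebraMap A R a0 * x3 = x1 * x2 ^ 2)
    (h3 : algebraMap A R a0 * algebraMap A R a4 = x1 * x3)
    (h4 : x1 * x3 = x2 ^ 3) (h5 : x1 * algebraMap A R a4 = x2 * x3)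
    (h6 : x2 ^ 2 * algebraMap A R a4 = x3 ^ 2)
    (hgen : Algebra.adjoin A {x1, x2, x3} = ⊤) :
    Submodule.span A (Set.range (gens x1 x2 x3)) = ⊤ := by
  set N := Submodule.span A (Set.range (gens x1 x2 x3)) with hN
  have g : ∀ i, gens x1 x2 x3 i ∈ N := fun i => Submodule.subset_span ⟨i, rfl⟩
  have gs : ∀ (a : A) (i : Fin 6) (y : R), y = algebraMap A R a * gens x1 x2 x3 i → y ∈ N := by
    rintro a i y rfl
    rw [← Algebra.smul_def]
    exact N.smul_mem _ (g i)
  have clos : ∀ x : R, (∀ i, x * gens x1 x2 x3 i ∈ N) → ∀ y ∈ N, x * y ∈ N := by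
    intro x hx y hy
    induction hy using Submodule.span_induction with
    | mem y hy => obtain ⟨i, rfl⟩ := hy; exact hx i
    | zero => simp
    | add y z _ _ hy hz => rw [mul_add]; exact N.add_mem hy hz
    | smul a y _ hy => rw [mul_smul_comm]; exact N.smul_mem _ hy
  have c1 : ∀ y ∈ N, x1 * y ∈ N := by
    apply clos
    intro i
    fin_cases i
    · exact gs 1 1 _ (by simp [gens])
    · exact gs a0 2 _ (by simp [gens]; linear_combination -h1)
    · exact gs 1 3 _ (by simp [gens])
    · exact gs a0 4 _ (by simp [gens]; linear_combination -x2 * h1)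
    · exact gs a0 5 _ (by simp [gens]; linear_combination -h2)
    · exact gs (a0 * a4) 0 _ (by simp [gens]; linear_combination -h3)
  have c2 : ∀ y ∈ N, x2 * y ∈ N := by
    apply clos
    intro i
    fin_cases i
    · exact gs 1 2 _ (by simp [gens])
    · exact gs 1 3 _ (by simp [gens]; ring)
    · exact gs 1 4 _ (by simp [gens]; ring)
    · exact gs a0 5 _ (by simp [gens]; linear_combination -h2)
    · exact gs (a0 * a4) 0 _ (by simp [gens]; linear_combination -h3 - h4)
    · exact gs a4 1 _ (by simp [gens]; linear_combination -h5)
  have c3 : ∀ y ∈ N, x3 * y ∈ N := by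
    apply clos
    intro i
    fin_cases i
    · exact gs 1 5 _ (by simp [gens])
    · exact gs (a0 * a4) 0 _ (by simp [gens]; linear_combination -h3)
    · exact gs a4 1 _ (by simp [gens]; linear_combination -h5)
    · exact gs (a0 * a4) 2 _ (by simp [gens]; linear_combination -x2 * h3)
    · exact gs a4 3 _ (by simp [gens]; linear_combination -x2 * h5)
    · exact gs a4 4 _ (by simp [gens]; linear_combination -h6)
  have main : ∀ x ∈ Algebra.adjoin A ({x1, x2, x3} : Set R), ∀ y ∈ N, x * y ∈ N := by
    intro x hx
    induction hx using Algebra.adjoin_induction with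
    | mem x hx =>
      rcases hx with rfl | rfl | rfl
      · exact c1
      · exact c2
      · exact c3
    | algebraMap a => intro y hy; rw [← Algebra.smul_def]; exact N.smul_mem _ hy
    | add p q _ _ hp hq => intro y hy; rw [add_mul]; exact N.add_mem (hp y hy) (hq y hy)
    | mul p q _ _ hp hq => intro y hy; rw [mul_assoc]; exact hp _ (hq y hy)
  rw [eq_top_iff]
  intro x _
  have := main x (by rw [hgen]; trivial) 1 (by simpa [gens] using g 0)
  simpa using this

/-- The parametrization. -/
noncomputable def phi : MvPolynomial (Fin 5) k →ₐ[k] MvPolynomial (Fin 2) k :=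
  aeval ![X 0 ^ 3, X 0 ^ 2 * X 1, X 0 * X 1 ^ 2, X 0 * X 1 ^ 5, X 1 ^ 6]

theorem phi_X (i : Fin 5) : phi k (X i) =
    (![X 0 ^ 3, X 0 ^ 2 * X 1, X 0 * X 1 ^ 2, X 0 * X 1 ^ 5, X 1 ^ 6] :
      Fin 5 → MvPolynomial (Fin 2) k) i := aeval_X _ _

theorem phi_ker : Ideal.span
      {X 0 * X 2 - X 1 ^ 2, X 0 * X 3 - X 1 * X 2 ^ 2, X 0 * X 4 - X 1 * X 3,
       X 1 * X 3 - X 2 ^ 3, X 1 * X 4 - X 2 * X 3, X 2 ^ 2 * X 4 - X 3 ^ 2}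
    ≤ RingHom.ker (phi k) := by
  refine Ideal.span_le.2 ?_
  rintro q (rfl | rfl | rfl | rfl | rfl | rfl) <;>
  · simp only [SetLike.mem_coe, RingHom.mem_ker, map_sub, map_mul, map_pow, phi_X]
    simp
    ring

end Stmt17Aux

/-- Let `S = k[x_0,…,x_4]` be the Cox ring of the weighted projective space
`ℙ(1,1,1,2,2)` and `I_C` the ideal of `2×2` minors of `[[x_0, x_1, x_2², x_3],[x_1, x_2, x_3,
x_4]]`.  Then `S/I_C` is Cohen–Macaulay of codimension 3: `dim S/I_C = 2`, the codimension of
`I_C` is `3` (so `dim (S/I_C) + 3 = dim S`), and the depth of `S/I_C` (at the irrelevant maximal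
ideal) equals `2`, witnessed by a regular sequence of length two of elements of the irrelevant
ideal. -/
theorem stmt17 (k : Type) [Field k] :
    let S := MvPolynomial (Fin 5) k
    let I : Ideal S := Ideal.span
      {X 0 * X 2 - X 1 ^ 2, X 0 * X 3 - X 1 * X 2 ^ 2, X 0 * X 4 - X 1 * X 3,
       X 1 * X 3 - X 2 ^ 3, X 1 * X 4 - X 2 * X 3, X 2 ^ 2 * X 4 - X 3 ^ 2}
    -- `dim S/I_C = 2`
    ringKrullDim (S ⧸ I) = 2 ∧
    -- codimension 3
    ringKrullDim (S ⧸ I) + 3 = ringKrullDim S ∧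
    -- Cohen–Macaulayness: depth = dim = 2, via a regular sequence `f, g` of length two
    (∃ f g : S,
      f ∈ Ideal.span (Set.range (X : Fin 5 → S)) ∧
      g ∈ Ideal.span (Set.range (X : Fin 5 → S)) ∧
      IsSMulRegular (S ⧸ I) (Ideal.Quotient.mk I f) ∧
      IsSMulRegular ((S ⧸ I) ⧸ Ideal.span {Ideal.Quotient.mk I f})
        (Ideal.Quotient.mk (Ideal.span {Ideal.Quotient.mk I f}) (Ideal.Quotient.mk I g)) ∧
      Ideal.span {Ideal.Quotient.mk I f, Ideal.Quotient.mk I g} ≠ (⊤ : Ideal (S ⧸ I))) := by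
  intro S I
  have hI : ∀ p ∈ I, Stmt17Aux.phi k p = 0 := fun p hp => Stmt17Aux.phi_ker k hp
  let phiQ : S ⧸ I →+* MvPolynomial (Fin 2) k :=
    Ideal.Quotient.lift I (Stmt17Aux.phi k).toRingHom hI
  have hQ : ∀ i, phiQ (Ideal.Quotient.mk I (X i)) =
      (![X 0 ^ 3, X 0 ^ 2 * X 1, X 0 * X 1 ^ 2, X 0 * X 1 ^ 5, X 1 ^ 6] :
        Fin 5 → MvPolynomial (Fin 2) k) i := fun i => Stmt17Aux.phi_X k i
  let alpha : MvPolynomial (Fin 2) k →ₐ[k] S ⧸ I :=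
    aeval ![Ideal.Quotient.mk I (X 0), Ideal.Quotient.mk I (X 4)]
  have ha0 : alpha (X 0) = Ideal.Quotient.mk I (X 0) := by simp [alpha]
  have ha1 : alpha (X 1) = Ideal.Quotient.mk I (X 4) := by simp [alpha]
  have hpa : ∀ c, phiQ (alpha c) = Stmt17Aux.psi k c := by
    intro c
    have : phiQ.comp alpha.toRingHom = (Stmt17Aux.psi k).toRingHom := by
      refine MvPolynomial.ringHom_ext ?_ ?_
      · intro r
        have : alpha (C r) = Ideal.Quotient.mk I (C r) := alpha.commutes r
        change phiQ (alpha (C r)) = Stmt17Aux.psi k (C r)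
        rw [this]
        exact ((Stmt17Aux.phi k).commutes r).trans ((Stmt17Aux.psi k).commutes r).symm
      · intro i
        fin_cases i
        · change phiQ (alpha (X 0)) = Stmt17Aux.psi k (X 0)
          rw [ha0, hQ]
          simp [Stmt17Aux.psi]
        · change phiQ (alpha (X 1)) = Stmt17Aux.psi k (X 1)
          rw [ha1, hQ]
          simp [Stmt17Aux.psi]
    exact RingHom.congr_fun this c
  letI : Algebra (MvPolynomial (Fin 2) k) (S ⧸ I) := alpha.toRingHom.toAlgebra
  have hal : ∀ c, algebraMap (MvPolynomial (Fin 2) k) (S ⧸ I) c = alpha c := fun c => rfl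
  let x : Fin 5 → S ⧸ I := fun i => Ideal.Quotient.mk I (X i)
  let v := Stmt17Aux.gens (x 1) (x 2) (x 3)
  have rel : ∀ p q : S, p - q ∈ I → Ideal.Quotient.mk I p = Ideal.Quotient.mk I q :=
    fun p q h => Ideal.Quotient.eq.2 h
  have hspan : Submodule.span (MvPolynomial (Fin 2) k) (Set.range v) = ⊤ := by
    refine Stmt17Aux.span_top (X 0) (X 1) (x 1) (x 2) (x 3) ?_ ?_ ?_ ?_ ?_ ?_ ?_
    · rw [hal, ha0]; exact rel (X 0 * X 2) (X 1 ^ 2) (Ideal.subset_span (by simp))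
    · rw [hal, ha0]; exact rel (X 0 * X 3) (X 1 * X 2 ^ 2) (Ideal.subset_span (by simp))
    · rw [hal, hal, ha0, ha1]; exact rel (X 0 * X 4) (X 1 * X 3) (Ideal.subset_span (by simp))
    · exact rel (X 1 * X 3) (X 2 ^ 3) (Ideal.subset_span (by simp))
    · rw [hal, ha1]; exact rel (X 1 * X 4) (X 2 * X 3) (Ideal.subset_span (by simp))
    · rw [hal, ha1]; exact rel (X 2 ^ 2 * X 4) (X 3 ^ 2) (Ideal.subset_span (by simp))
    · rw [eq_top_iff]
      intro y _
      obtain ⟨p, rfl⟩ := Ideal.Quotient.mk_surjective y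
      induction p using MvPolynomial.induction_on with
      | C r =>
        have : alpha (C r) = Ideal.Quotient.mk I (C r) := alpha.commutes r
        rw [← this, ← hal]
        exact Subalgebra.algebraMap_mem _ _
      | add p q hp hq => rw [map_add]; exact Subalgebra.add_mem _ (hp trivial) (hq trivial)
      | mul_X p i hp =>
        rw [map_mul]
        refine Subalgebra.mul_mem _ (hp trivial) ?_
        fin_cases i
        · change Ideal.Quotient.mk I (X 0) ∈ _
          rw [← ha0, ← hal]; exact Subalgebra.algebraMap_mem _ _
        · exact Algebra.subset_adjoin (Or.inl rfl)
        · exact Algebra.subset_adjoin (Or.inr (Or.inl rfl))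
        · exact Algebra.subset_adjoin (Or.inr (Or.inr rfl))
        · change Ideal.Quotient.mk I (X 4) ∈ _
          rw [← ha1, ← hal]; exact Subalgebra.algebraMap_mem _ _
  have hv : ∀ j, phiQ (v j) = monomial (Stmt17Aux.base j) 1 := by
    have hx1 : phiQ (x 1) = X 0 ^ 2 * X 1 := (hQ _).trans (by simp)
    have hx2 : phiQ (x 2) = X 0 * X 1 ^ 2 := (hQ _).trans (by simp)
    have hx3 : phiQ (x 3) = X 0 * X 1 ^ 5 := (hQ _).trans (by simp)
    have mon : ∀ a b : ℕ, (monomial (Finsupp.single 0 a + Finsupp.single 1 b) 1 :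
        MvPolynomial (Fin 2) k) = X 0 ^ a * X 1 ^ b := by
      intro a b
      simp [X_pow_eq_monomial, monomial_mul]
    intro j
    fin_cases j <;> simp [v, Stmt17Aux.gens, Stmt17Aux.base, hx1, hx2, hx3, mon] <;> ring
  have hlin : LinearIndependent (MvPolynomial (Fin 2) k) v := by
    rw [Fintype.linearIndependent_iff]
    intro c hc
    have h := congrArg phiQ hc
    simp only [Algebra.smul_def, map_sum, map_mul, hal, hpa, hv, map_zero] at h
    exact fun i => congrFun (Stmt17Aux.psi_indep k c h) i
  let b := Module.Basis.mk hlin hspan.ge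
  obtain ⟨hd, hr0, hr1⟩ := Stmt17Aux.free_consequences k b.equivFun.symm
  rw [hal, ha0] at hr0
  rw [hal, hal, ha0, ha1] at hr1
  refine ⟨hd, ?_, X 0, X 4, Ideal.subset_span ⟨0, rfl⟩, Ideal.subset_span ⟨4, rfl⟩, hr0, hr1, ?_⟩
  · rw [hd, MvPolynomial.ringKrullDim_of_isNoetherianRing, ringKrullDim_eq_zero_of_field]
    simp
    norm_num
  · intro htop
    let ev : S ⧸ I →+* k := (constantCoeff).comp phiQ
    have hle : Ideal.span {Ideal.Quotient.mk I (X 0), Ideal.Quotient.mk I (X 4)}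
        ≤ RingHom.ker ev := by
      refine Ideal.span_le.2 ?_
      rintro q (rfl | rfl)
      · change constantCoeff (phiQ _) = 0
        rw [hQ]; simp
      · change constantCoeff (phiQ _) = 0
        rw [hQ]; simp
    rw [htop] at hle
    have : ev 1 = 0 := hle trivial
    simp at this
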